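/- arXiv:2204.11924 — 2 statements merged into one kernel-verified Lean document; each statement's English description precedes it below -/
import Mathlib

section
/- Under the assumptions that Φ is separating and uniformly A-Lipschitz with |f(0)| ≤ A, the generalized maximum mean discrepancy D_Φ is a metric on the space P¹(E) of probability measures with finite first moment: for all μ, μ', μ'' ∈ P¹(E), D_Φ(μ,μ') is finite and nonnegative, D_Φ(μ,μ') = D_Φ(μ',μ), D_Φ(μ,μ'') ≤ D_Φ(μ,μ') + D_Φ(μ',μ''), and D_Φ(μ,μ') = 0 if and only if μ = μ'. -/
open MeasureTheory

/-- The generalized maximum mean discrepancy (GMMD) between two measures on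
`E = ℝ^m` (with the Euclidean norm), associated with a class `Φ` of test functions. -/
noncomputable def gmmd {m : ℕ} (Φ : Set (EuclideanSpace ℝ (Fin m) → ℝ))
    (μ μ' : Measure (EuclideanSpace ℝ (Fin m))) : ℝ :=
  sSup ((fun f => |(∫ x, f x ∂μ) - ∫ x, f x ∂μ'|) '' Φ)

/-- A function `f` with `|f 0| ≤ A` and Lipschitz constant `A` is dominated by `A + A * ‖x‖`, and so
is its integral. -/
lemma abs_integral_le_of_lipschitz {m : ℕ} {f : EuclideanSpace ℝ (Fin m) → ℝ} {A : ℝ}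
    (hLip : ∀ x y, |f x - f y| ≤ A * ‖x - y‖) (hf0 : |f 0| ≤ A)
    (μ : Measure (EuclideanSpace ℝ (Fin m))) [IsFiniteMeasure μ]
    (hμ : Integrable (fun x => ‖x‖) μ) :
    |∫ x, f x ∂μ| ≤ ∫ x, (A + A * ‖x‖) ∂μ := by
  rw [← Real.norm_eq_abs]
  refine norm_integral_le_of_norm_le ((integrable_const A).add (hμ.const_mul A)) (.of_forall ?_)
  intro x
  have h := hLip x 0
  rw [sub_zero] at h
  rw [Real.norm_eq_abs]
  linarith [abs_sub_abs_le_abs_sub (f x) (f 0)]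

lemma gmmd_nonneg {m : ℕ} (Φ : Set (EuclideanSpace ℝ (Fin m) → ℝ))
    (μ μ' : Measure (EuclideanSpace ℝ (Fin m))) : 0 ≤ gmmd Φ μ μ' := by
  refine Real.sSup_nonneg ?_
  rintro _ ⟨f, -, rfl⟩
  exact abs_nonneg _

lemma gmmd_comm {m : ℕ} (Φ : Set (EuclideanSpace ℝ (Fin m) → ℝ))
    (μ μ' : Measure (EuclideanSpace ℝ (Fin m))) : gmmd Φ μ μ' = gmmd Φ μ' μ := by
  simp only [gmmd, abs_sub_comm]

/-- **GMMD is a metric on `P¹(E)`.** If `Φ` is separating and uniformly `A`-Lipschitz with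
`|f 0| ≤ A`, then for all probability measures `μ, μ', μ''` with finite first moment, the
GMMD is finite (the defining set is bounded above), nonnegative, symmetric, satisfies the
triangle inequality, and vanishes iff the measures are equal. -/
theorem gmmd_is_metric {m : ℕ} (Φ : Set (EuclideanSpace ℝ (Fin m) → ℝ))
    (A : ℝ) (hA : 0 < A)
    (hLip : ∀ f ∈ Φ, ∀ x y : EuclideanSpace ℝ (Fin m), |f x - f y| ≤ A * ‖x - y‖)
    (hf0 : ∀ f ∈ Φ, |f 0| ≤ A)
    (hsep : ∀ ν₁ ν₂ : Measure (EuclideanSpace ℝ (Fin m)),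
      IsFiniteMeasure ν₁ → IsFiniteMeasure ν₂ →
      Integrable (fun x => ‖x‖) ν₁ → Integrable (fun x => ‖x‖) ν₂ →
      (∀ f ∈ Φ, (∫ x, f x ∂ν₁) = ∫ x, f x ∂ν₂) → ν₁ = ν₂) :
    ∀ μ μ' μ'' : Measure (EuclideanSpace ℝ (Fin m)),
      IsProbabilityMeasure μ → IsProbabilityMeasure μ' → IsProbabilityMeasure μ'' →
      Integrable (fun x => ‖x‖) μ → Integrable (fun x => ‖x‖) μ' →
      Integrable (fun x => ‖x‖) μ'' →
      BddAbove ((fun f => |(∫ x, f x ∂μ) - ∫ x, f x ∂μ'|) '' Φ) ∧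
      0 ≤ gmmd Φ μ μ' ∧
      gmmd Φ μ μ' = gmmd Φ μ' μ ∧
      gmmd Φ μ μ'' ≤ gmmd Φ μ μ' + gmmd Φ μ' μ'' ∧
      (gmmd Φ μ μ' = 0 ↔ μ = μ') := by
  intro μ μ' μ'' hp hp' hp'' hμ hμ' hμ''
  have bdd : ∀ ν₁ ν₂ : Measure (EuclideanSpace ℝ (Fin m)),
      IsProbabilityMeasure ν₁ → IsProbabilityMeasure ν₂ →
      Integrable (fun x => ‖x‖) ν₁ → Integrable (fun x => ‖x‖) ν₂ →
      BddAbove ((fun f => |(∫ x, f x ∂ν₁) - ∫ x, f x ∂ν₂|) '' Φ) := by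
    intro ν₁ ν₂ _ _ h₁ h₂
    refine ⟨(∫ x, (A + A * ‖x‖) ∂ν₁) + ∫ x, (A + A * ‖x‖) ∂ν₂, ?_⟩
    rintro _ ⟨f, hf, rfl⟩
    exact (abs_sub _ _).trans (add_le_add
      (abs_integral_le_of_lipschitz (hLip f hf) (hf0 f hf) ν₁ h₁)
      (abs_integral_le_of_lipschitz (hLip f hf) (hf0 f hf) ν₂ h₂))
  have b := bdd μ μ' hp hp' hμ hμ'
  have b' := bdd μ' μ'' hp' hp'' hμ' hμ''
  refine ⟨b, gmmd_nonneg Φ μ μ', gmmd_comm Φ μ μ', ?_, ?_, ?_⟩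
  · refine Real.sSup_le ?_ (add_nonneg (gmmd_nonneg Φ μ μ') (gmmd_nonneg Φ μ' μ''))
    rintro _ ⟨f, hf, rfl⟩
    exact (abs_sub_le _ (∫ x, f x ∂μ') _).trans
      (add_le_add (le_csSup b ⟨f, hf, rfl⟩) (le_csSup b' ⟨f, hf, rfl⟩))
  · intro h
    refine hsep μ μ' inferInstance inferInstance hμ hμ' fun f hf => ?_
    have hle : |(∫ x, f x ∂μ) - ∫ x, f x ∂μ'| ≤ gmmd Φ μ μ' := le_csSup b ⟨f, hf, rfl⟩
    rw [h] at hle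
    exact sub_eq_zero.mp (abs_nonpos_iff.mp hle)
  · rintro rfl
    refine le_antisymm (Real.sSup_le ?_ le_rfl) (gmmd_nonneg Φ μ μ)
    rintro _ ⟨f, -, rfl⟩
    simp
end

section
/- (Iterated Gronwall convolution estimate.) Let T > 0, C ≥ 0, K ∈ ℕ, let δ₀, δ₁, …, δ_K : [0,T] → [0,∞) be integrable functions, and let I₁, …, I_K ≥ 0 be constants such that for every k ∈ {1,…,K} and every t ∈ [0,T], δ_k(t) ≤ C ∫₀ᵗ δ_{k−1}(s) ds + I_k. Then for every k ∈ {1,…,K} and every t ∈ [0,T]: ∫₀ᵗ δ_k(s) ds ≤ (C^k / k!) ∫₀ᵗ (t − s)^k δ₀(s) ds + ∑_{j=1}^{k} (C^{j−1} t^j / j!) · I_{k+1−j}. -/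
open MeasureTheory intervalIntegral

/-- The truncated power kernel `(s - r)ᵏ 𝟙_{r ≤ s}` times an integrable function of `r` is
integrable on the square. -/
theorem integrable_prod_sub_pow_mul_of_le {f : ℝ → ℝ} {t : ℝ}
    (hf : IntegrableOn f (Set.Ioc 0 t)) (k : ℕ) :
    Integrable
      (Function.uncurry fun s r : ℝ ↦ (if r ≤ s then (s - r) ^ k else 0) * f r)
      ((volume.restrict (Set.Ioc 0 t)).prod (volume.restrict (Set.Ioc 0 t))) := by
  have hsnd : Integrable (fun p : ℝ × ℝ ↦ f p.2)
      ((volume.restrict (Set.Ioc 0 t)).prod (volume.restrict (Set.Ioc 0 t))) :=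
    Integrable.comp_snd hf _
  refine hsnd.bdd_mul (c := t ^ k) ?_ ?_
  · refine (Measurable.ite ?_ ?_ measurable_const).aestronglyMeasurable
    · exact measurableSet_le measurable_snd measurable_fst
    · fun_prop
  · rw [Measure.prod_restrict]
    refine (ae_restrict_iff' (measurableSet_Ioc.prod measurableSet_Ioc)).2 (.of_forall ?_)
    rintro ⟨s, r⟩ ⟨⟨hs0, hst⟩, ⟨hr0, hrt⟩⟩
    simp only at hs0 hst hr0 hrt ⊢
    split_ifs with h
    · rw [Real.norm_of_nonneg (pow_nonneg (sub_nonneg.2 h) k)]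
      exact pow_le_pow_left₀ (sub_nonneg.2 h) (by linarith) k
    · simpa using pow_nonneg (hs0.le.trans hst) k

theorem setIntegral_ite_sub_pow_mul_eq (f : ℝ → ℝ) {s t : ℝ} (hs : s ∈ Set.Ioc 0 t) (k : ℕ) :
    ∫ r in Set.Ioc 0 t, (if r ≤ s then (s - r) ^ k else 0) * f r =
      ∫ r in (0 : ℝ)..s, (s - r) ^ k * f r := by
  have h : (fun r ↦ (if r ≤ s then (s - r) ^ k else 0) * f r) =
      (Set.Iic s).indicator fun r ↦ (s - r) ^ k * f r := by
    ext r
    by_cases hr : r ≤ s <;> simp [hr]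
  rw [h, setIntegral_indicator measurableSet_Iic, integral_of_le hs.1.le,
    Set.Ioc_inter_Iic, min_eq_right hs.2]

theorem setIntegral_ite_sub_pow_mul_const (c : ℝ) {r t : ℝ} (hr : r ∈ Set.Ioc 0 t) (k : ℕ) :
    ∫ s in Set.Ioc 0 t, (if r ≤ s then (s - r) ^ k else 0) * c =
      (t - r) ^ (k + 1) / (k + 1) * c := by
  have h : (fun s ↦ if r ≤ s then (s - r) ^ k else 0) =
      (Set.Ici r).indicator fun s ↦ (s - r) ^ k := by
    ext s
    by_cases hs : r ≤ s <;> simp [hs]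
  have hset : Set.Ioc 0 t ∩ Set.Ici r = Set.Icc r t := by
    ext s
    simp only [Set.mem_inter_iff, Set.mem_Ioc, Set.mem_Ici, Set.mem_Icc]
    exact ⟨fun hs ↦ ⟨hs.2, hs.1.2⟩, fun hs ↦ ⟨⟨hr.1.trans_le hs.1, hs.2⟩, hs.1⟩⟩
  rw [MeasureTheory.integral_mul_const, h, setIntegral_indicator measurableSet_Ici, hset,
    integral_Icc_eq_integral_Ioc, ← integral_of_le hr.2,
    integral_comp_sub_right (fun x ↦ x ^ k) r, integral_pow]
  simp

/-- The convolution of an integrable function with a power is integrable. -/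
theorem intervalIntegrable_integral_sub_pow_mul {f : ℝ → ℝ} {t : ℝ} (ht : 0 ≤ t)
    (hf : IntegrableOn f (Set.Ioc 0 t)) (k : ℕ) :
    IntervalIntegrable (fun s ↦ ∫ r in (0 : ℝ)..s, (s - r) ^ k * f r) volume 0 t := by
  rw [intervalIntegrable_iff_integrableOn_Ioc_of_le ht]
  refine (integrable_prod_sub_pow_mul_of_le hf k).integral_prod_left.congr ?_
  filter_upwards [ae_restrict_mem measurableSet_Ioc] with s hs
  exact setIntegral_ite_sub_pow_mul_eq f hs k

/-- Cauchy's formula for repeated integration, inductive step. -/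
theorem integral_integral_sub_pow_mul {f : ℝ → ℝ} {t : ℝ} (ht : 0 ≤ t)
    (hf : IntegrableOn f (Set.Ioc 0 t)) (k : ℕ) :
    ∫ s in (0 : ℝ)..t, ∫ r in (0 : ℝ)..s, (s - r) ^ k * f r =
      (∫ r in (0 : ℝ)..t, (t - r) ^ (k + 1) * f r) / (k + 1) := by
  rw [integral_of_le ht, integral_of_le ht, ← MeasureTheory.integral_div,
    ← setIntegral_congr_fun measurableSet_Ioc
      fun s hs ↦ setIntegral_ite_sub_pow_mul_eq f hs k,
    integral_integral_swap (integrable_prod_sub_pow_mul_of_le hf k)]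
  refine setIntegral_congr_fun measurableSet_Ioc fun r hr ↦ ?_
  simp only [setIntegral_ite_sub_pow_mul_const (f r) hr k]
  ring

theorem integral_sum_pow_div_factorial (C t : ℝ) (I : ℕ → ℝ) (k : ℕ) :
    ∫ s in (0 : ℝ)..t, (C * (∑ j ∈ Finset.Icc 1 k,
        C ^ (j - 1) * s ^ j / (Nat.factorial j) * I (k + 1 - j)) + I (k + 1)) =
      ∑ j ∈ Finset.Icc 1 (k + 1),
        C ^ (j - 1) * t ^ j / (Nat.factorial j) * I (k + 1 + 1 - j) := by
  rw [intervalIntegral.integral_add (Continuous.intervalIntegrable (by fun_prop) _ _) (by simp),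
    intervalIntegral.integral_const_mul, intervalIntegral.integral_finsetSum
      fun j _ ↦ Continuous.intervalIntegrable (by fun_prop) _ _,
    Finset.mul_sum]
  simp only [← Finset.Ico_add_one_right_eq_Icc, Finset.sum_Ico_eq_sum_range, Nat.add_sub_cancel]
  rw [Finset.sum_range_succ']
  congr 1
  · refine Finset.sum_congr rfl fun j _ ↦ ?_
    have h1 : k + 1 + 1 - (1 + (j + 1)) = k + 1 - (1 + j) := by omega
    rw [h1, intervalIntegral.integral_mul_const, intervalIntegral.integral_div,
      intervalIntegral.integral_const_mul, integral_pow,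
      show 1 + (j + 1) = j + 1 + 1 by omega, show 1 + j = j + 1 by omega,
      Nat.factorial_succ (j + 1)]
    simp only [Nat.add_sub_cancel]
    push_cast
    field_simp
    ring
  · simp

/-- **Iterated Gronwall convolution estimate.** If integrable nonnegative functions
`δ₀, …, δ_K` on `[0,T]` satisfy `δ_k(t) ≤ C ∫₀ᵗ δ_{k−1}(s) ds + I_k` with `I_k ≥ 0`, then
`∫₀ᵗ δ_k(s) ds ≤ (Cᵏ/k!) ∫₀ᵗ (t−s)ᵏ δ₀(s) ds + ∑_{j=1}^k (C^{j−1} tʲ / j!) I_{k+1−j}`. -/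
theorem iterated_gronwall (T : ℝ) (hT : 0 < T) (C : ℝ) (hC : 0 ≤ C) (K : ℕ)
    (δ : ℕ → ℝ → ℝ) (I : ℕ → ℝ)
    (hδnn : ∀ k ≤ K, ∀ t ∈ Set.Icc (0 : ℝ) T, 0 ≤ δ k t)
    (hδint : ∀ k ≤ K, IntegrableOn (δ k) (Set.Icc (0 : ℝ) T))
    (hInn : ∀ k, 1 ≤ k → k ≤ K → 0 ≤ I k)
    (hrec : ∀ k, 1 ≤ k → k ≤ K → ∀ t ∈ Set.Icc (0 : ℝ) T,
      δ k t ≤ C * (∫ s in (0 : ℝ)..t, δ (k - 1) s) + I k) :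
    ∀ k, 1 ≤ k → k ≤ K → ∀ t ∈ Set.Icc (0 : ℝ) T,
      (∫ s in (0 : ℝ)..t, δ k s) ≤
        C ^ k / (Nat.factorial k) * (∫ s in (0 : ℝ)..t, (t - s) ^ k * δ 0 s) +
          ∑ j ∈ Finset.Icc 1 k, C ^ (j - 1) * t ^ j / (Nat.factorial j) * I (k + 1 - j) := by
  suffices h : ∀ k ≤ K, ∀ t ∈ Set.Icc (0 : ℝ) T,
      (∫ s in (0 : ℝ)..t, δ k s) ≤
        C ^ k / (Nat.factorial k) * (∫ s in (0 : ℝ)..t, (t - s) ^ k * δ 0 s) +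
          ∑ j ∈ Finset.Icc 1 k, C ^ (j - 1) * t ^ j / (Nat.factorial j) * I (k + 1 - j) from
    fun k _ hk ↦ h k hk
  intro k
  induction k with
  | zero => simp
  | succ k ih =>
    intro hk t ht
    have hsub : Set.Ioc 0 t ⊆ Set.Icc 0 T := fun s hs ↦ ⟨hs.1.le, hs.2.trans ht.2⟩
    have hδ0 : IntegrableOn (δ 0) (Set.Ioc 0 t) := (hδint 0 K.zero_le).mono_set hsub
    have hconv := (intervalIntegrable_integral_sub_pow_mul ht.1 hδ0 k).const_mul
      (C * (C ^ k / (Nat.factorial k)))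
    have hpoly : IntervalIntegrable (fun s : ℝ ↦ C * (∑ j ∈ Finset.Icc 1 k,
        C ^ (j - 1) * s ^ j / (Nat.factorial j) * I (k + 1 - j)) + I (k + 1)) volume 0 t :=
      Continuous.intervalIntegrable (by fun_prop) _ _
    calc ∫ s in (0 : ℝ)..t, δ (k + 1) s
        ≤ ∫ s in (0 : ℝ)..t, (C * (C ^ k / (Nat.factorial k)) *
            (∫ r in (0 : ℝ)..s, (s - r) ^ k * δ 0 r) + (C * (∑ j ∈ Finset.Icc 1 k,
              C ^ (j - 1) * s ^ j / (Nat.factorial j) * I (k + 1 - j)) + I (k + 1))) := by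
          refine integral_mono_on ht.1 ?_ (hconv.add hpoly) fun s hs ↦ ?_
          · exact (intervalIntegrable_iff_integrableOn_Ioc_of_le ht.1).2
              ((hδint (k + 1) hk).mono_set hsub)
          · have hsT : s ∈ Set.Icc 0 T := ⟨hs.1, hs.2.trans ht.2⟩
            have h1 := hrec (k + 1) (by omega) hk s hsT
            have h2 := mul_le_mul_of_nonneg_left (ih (by omega) s hsT) hC
            rw [Nat.add_sub_cancel] at h1
            linarith
      _ = _ := by
          rw [intervalIntegral.integral_add hconv hpoly, intervalIntegral.integral_const_mul,
            integral_integral_sub_pow_mul ht.1 hδ0, integral_sum_pow_div_factorial,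
            Nat.factorial_succ]
          congr 1
          push_cast
          field_simp
          ring
end
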